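/- arXiv:1309.2697 — 3 statements merged into one kernel-verified Lean document; each statement's English description precedes it below -/
import Mathlib

section
/- Let F_n denote the number of full perfect matchings of 2n points on a circle (n ≥ 1). Then F_1 = 1 and, for every n ≥ 2, F_n = 2(n−1)·F_{n−1} + Σ_{j=2}^{n−2} (j−1)·F_j·F_{n−j}, where the sum is empty for n ≤ 3. -/
/-- `M` is a perfect matching of the `2n` points `0, 1, …, 2n-1` placed in clockwise
order on a circle: a set of pairwise disjoint unordered pairs covering all `2n` points. -/
def IsPerfectMatching (n : ℕ) (M : Finset (Finset ℕ)) : Prop :=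
  (∀ p ∈ M, p.card = 2) ∧
  (∀ p ∈ M, ∀ x ∈ p, x < 2 * n) ∧
  (∀ p ∈ M, ∀ q ∈ M, p ≠ q → Disjoint p q) ∧
  (∀ x, x < 2 * n → ∃ p ∈ M, x ∈ p)

/-- The chord `V_i V_j` (where the boundary vertex `V_i` lies between points `2i-2` and
`2i-1`, and `1 ≤ i < j ≤ n`) is a dividing line for `M` if no pair of `M` has exactly one
element in `{2i-1, …, 2j-2}`. -/
def IsDividingLine (n i j : ℕ) (M : Finset (Finset ℕ)) : Prop :=
  1 ≤ i ∧ i < j ∧ j ≤ n ∧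
    ∀ p ∈ M, (p ∩ Finset.Icc (2 * i - 1) (2 * j - 2)).card ≠ 1

/-- `M` is full if it has no dividing line. -/
def IsFull (n : ℕ) (M : Finset (Finset ℕ)) : Prop :=
  ∀ i j, ¬ IsDividingLine n i j M

/-- `F n`: the number of full perfect matchings of `2n` points on a circle. -/
noncomputable def fullCount (n : ℕ) : ℕ :=
  Set.ncard {M : Finset (Finset ℕ) | IsPerfectMatching n M ∧ IsFull n M}

/-- `f` maps the half-open interval `[a, b)` into itself. -/
def StableOn (f : ℕ → ℕ) (a b : ℕ) : Prop := ∀ x, a ≤ x → x < b → a ≤ f x ∧ f x < b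

/-- Involutions of `ℕ` whose fixed points are exactly the `x ≥ 2n`: they encode the perfect
matchings of `0, …, 2n-1`. -/
def matchingInvolutions (n : ℕ) : Set (ℕ → ℕ) := {f | (∀ x, f (f x) = x) ∧ ∀ x, f x = x ↔ 2 * n ≤ x}

theorem matchingInvolutions.lt {n f} (hf : f ∈ matchingInvolutions n) {x : ℕ} (hx : x < 2 * n) : f x < 2 * n := by
  obtain ⟨h1, h2⟩ := hf
  by_contra! h
  have := (h2 _).2 h
  rw [h1] at this
  have := (h2 x).1 this.symm
  omega

/-- Insert a new chord joining `k` to the new last point `2n+1`. -/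
def insertChord (n k : ℕ) (f : ℕ → ℕ) (x : ℕ) : ℕ :=
  if x = k then 2*n+1 else if x = 2*n+1 then k else if 2*n+1 < x then x else
    if f (if x < k then x else x - 1) < k then f (if x < k then x else x - 1)
    else f (if x < k then x else x - 1) + 1

theorem insertChord_mem {n k f} (hk : k < 2*n+1) (hf : f ∈ matchingInvolutions n) : insertChord n k f ∈ matchingInvolutions (n+1) := by
  have h0 := fun x => matchingInvolutions.lt hf (x := x)
  obtain ⟨h1, h2⟩ := hf
  refine ⟨fun x => ?_, fun x => ?_⟩
  · unfold insertChord; grind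
  · unfold insertChord; grind

/-- Insert the matching `h` of `2g` points at position `2m+1` of the matching `f`. -/
def insertInterval (m g : ℕ) (f h : ℕ → ℕ) (x : ℕ) : ℕ :=
  if x < 2*m+1 then (if f x < 2*m+1 then f x else f x + 2*g)
  else if x < 2*m+1+2*g then h (x-(2*m+1)) + (2*m+1)
  else (if f (x-2*g) < 2*m+1 then f (x-2*g) else f (x-2*g) + 2*g)

theorem insertInterval_mem {m g r f h} (hf : f ∈ matchingInvolutions r) (hr : m + 1 ≤ r) (hh : h ∈ matchingInvolutions g) : insertInterval m g f h ∈ matchingInvolutions (r + g) := by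
  have h0 := fun x => matchingInvolutions.lt hf (x := x)
  have h0' := fun x => matchingInvolutions.lt hh (x := x)
  obtain ⟨h1, h2⟩ := hf
  obtain ⟨h1', h2'⟩ := hh
  refine ⟨fun x => ?_, fun x => ?_⟩
  · unfold insertInterval; grind
  · unfold insertInterval; grind

theorem matchingInvolutions_finite (n : ℕ) : (matchingInvolutions n).Finite := by
  refine Set.Finite.of_injOn (f := fun f => fun x : Fin (2 * n) => (⟨f x % (2*n), Nat.mod_lt _ (by have := x.2; omega)⟩ : Fin (2*n)))
    (t := Set.univ) (fun _ _ => Set.mem_univ _) ?_ Set.finite_univ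
  intro f hf g hg h
  funext x
  by_cases hx : x < 2 * n
  · have := congrFun h ⟨x, hx⟩
    simp only [Fin.mk.injEq] at this
    rwa [Nat.mod_eq_of_lt (matchingInvolutions.lt hf hx), Nat.mod_eq_of_lt (matchingInvolutions.lt hg hx)] at this
  · rw [(hf.2 x).2 (by omega), (hg.2 x).2 (by omega)]

theorem ncard_matchingInvolutions_zero : (matchingInvolutions 0).ncard = 1 := by
  rw [Set.ncard_eq_one]
  refine ⟨id, ?_⟩
  ext f
  simp only [matchingInvolutions, Set.mem_ofPred_eq, Set.mem_singleton_iff]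
  constructor
  · rintro ⟨_, h⟩
    funext x
    exact (h x).2 (by omega)
  · rintro rfl
    simp

/-- Remove the chord joining `k` to the last point `2n+1`. -/
def removeChord (n k : ℕ) (f : ℕ → ℕ) (x : ℕ) : ℕ :=
  if 2 * n ≤ x then x else
    if f (if x < k then x else x + 1) < k then f (if x < k then x else x + 1)
    else f (if x < k then x else x + 1) - 1

theorem removeChord_mem {n f} (hf : f ∈ matchingInvolutions (n+1)) : removeChord n (f (2*n+1)) f ∈ matchingInvolutions n := by
  have h0 := fun x => matchingInvolutions.lt hf (x := x)
  obtain ⟨h1, h2⟩ := hf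
  have h3 := h1 (2*n+1)
  refine ⟨fun x => ?_, fun x => ?_⟩
  · unfold removeChord; grind
  · unfold removeChord; grind

theorem insertChord_removeChord {n f} (hf : f ∈ matchingInvolutions (n+1)) : insertChord n (f (2*n+1)) (removeChord n (f (2*n+1)) f) = f := by
  have h0 := fun x => matchingInvolutions.lt hf (x := x)
  obtain ⟨h1, h2⟩ := hf
  have h3 := h1 (2*n+1)
  funext x
  unfold insertChord removeChord; grind (splits := 25)

theorem removeChord_insertChord {n k f} (hf : f ∈ matchingInvolutions n) : removeChord n k (insertChord n k f) = f := by
  have h0 := fun x => matchingInvolutions.lt hf (x := x)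
  obtain ⟨h1, h2⟩ := hf
  funext x
  unfold insertChord removeChord; grind

theorem insertChord_last (n k f) (hk : k < 2*n+1) : insertChord n k f (2*n+1) = k := by
  unfold insertChord; grind

theorem ncard_matchingInvolutions_succ (n : ℕ) : (matchingInvolutions (n+1)).ncard = (2*n+1) * (matchingInvolutions n).ncard := by
  have : Set.BijOn (fun p : ℕ × (ℕ → ℕ) => insertChord n p.1 p.2) (Set.Iio (2*n+1) ×ˢ matchingInvolutions n) (matchingInvolutions (n+1)) := by
    refine ⟨fun p hp => insertChord_mem hp.1 hp.2, ?_, ?_⟩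
    · rintro ⟨k, f⟩ ⟨hk, hf⟩ ⟨k', f'⟩ ⟨hk', hf'⟩ h
      simp only [Set.mem_Iio] at h hk hk' hf hf'
      have e : k = k' := by rw [← insertChord_last n k f hk, h, insertChord_last n k' f' hk']
      subst e
      rw [← removeChord_insertChord hf, h, removeChord_insertChord hf']
    · intro f hf
      refine ⟨(f (2*n+1), removeChord n (f (2*n+1)) f), ⟨?_, removeChord_mem hf⟩, insertChord_removeChord hf⟩
      have := matchingInvolutions.lt hf (x := 2*n+1) (by omega)
      have := (hf.2 (2*n+1)).1
      simp only [Set.mem_Iio]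
      omega
  rw [← this.image_eq, this.injOn.ncard_image, Set.ncard_prod]
  simp

/-- Matchings with no stable interval `[2i+1, 2j+1)`, `i < j < n`, starting at some `i < m`. -/
def initiallyFull (m n : ℕ) : Set (ℕ → ℕ) :=
  {f | f ∈ matchingInvolutions n ∧ ∀ i j, i < m → i < j → j + 1 ≤ n → ¬ StableOn f (2*i+1) (2*j+1)}

/-- Matchings in `initiallyFull m n` whose longest stable interval of the form `[2m+1, 2j+1)`
has length `2g`. -/
def initiallyFullWithGap (m n g : ℕ) : Set (ℕ → ℕ) :=
  {f | f ∈ initiallyFull m n ∧ StableOn f (2*m+1) (2*(m+g)+1) ∧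
    ∀ j, m + g < j → j + 1 ≤ n → ¬ StableOn f (2*m+1) (2*j+1)}

/-- Remove the points of the interval `[2m+1, 2m+2g+1)`. -/
def removeInterval (m g : ℕ) (f : ℕ → ℕ) (x : ℕ) : ℕ :=
  if f (if x < 2*m+1 then x else x+2*g) < 2*m+1 then f (if x < 2*m+1 then x else x+2*g)
    else f (if x < 2*m+1 then x else x+2*g) - 2*g

/-- Restrict to the points of the interval `[2m+1, 2m+2g+1)`. -/
def restrictInterval (m g : ℕ) (f : ℕ → ℕ) (x : ℕ) : ℕ :=
  if x < 2 * g then f (x + (2*m+1)) - (2*m+1) else x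

theorem StableOn.not_mem_of_not_mem {n f} (hf : f ∈ matchingInvolutions n) {a b : ℕ} (h : StableOn f a b) (x : ℕ) (hx : ¬ (a ≤ x ∧ x < b)) :
    ¬ (a ≤ f x ∧ f x < b) := by
  intro h'
  have := h (f x) h'.1 h'.2
  rw [hf.1] at this
  exact hx this

theorem removeInterval_mem {m g r f} (hf : f ∈ matchingInvolutions (r + g)) (hr : m + 1 ≤ r) (hc : StableOn f (2*m+1) (2*(m+g)+1)) :
    removeInterval m g f ∈ matchingInvolutions r := by
  have h0 := fun x => matchingInvolutions.lt hf (x := x)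
  have h4 := StableOn.not_mem_of_not_mem hf hc
  unfold StableOn at hc
  obtain ⟨h1, h2⟩ := hf
  refine ⟨fun x => ?_, fun x => ?_⟩
  · unfold removeInterval; grind (splits := 25)
  · unfold removeInterval; grind

theorem restrictInterval_mem {m g r f} (hf : f ∈ matchingInvolutions (r + g)) (hr : m + 1 ≤ r) (hc : StableOn f (2*m+1) (2*(m+g)+1)) :
    restrictInterval m g f ∈ matchingInvolutions g := by
  unfold StableOn at hc
  obtain ⟨h1, h2⟩ := hf
  refine ⟨fun x => ?_, fun x => ?_⟩
  · unfold restrictInterval; grind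
  · unfold restrictInterval; grind

theorem insertInterval_remove_restrict {m g r f} (hf : f ∈ matchingInvolutions (r + g)) (hc : StableOn f (2*m+1) (2*(m+g)+1)) :
    insertInterval m g (removeInterval m g f) (restrictInterval m g f) = f := by
  have h4 := StableOn.not_mem_of_not_mem hf hc
  unfold StableOn at hc
  funext x
  unfold insertInterval restrictInterval removeInterval; grind

theorem removeInterval_insertInterval (m g f h) : removeInterval m g (insertInterval m g f h) = f := by
  funext x
  unfold insertInterval removeInterval; grind

theorem restrictInterval_insertInterval {m g f h} (hh : h ∈ matchingInvolutions g) : restrictInterval m g (insertInterval m g f h) = h := by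
  funext x
  have := hh.2 x
  unfold insertInterval restrictInterval; grind

theorem insertInterval_mem_initiallyFullWithGap {m g r f h} (hf : f ∈ initiallyFull (m+1) r) (hr : m + 1 ≤ r) (hh : h ∈ matchingInvolutions g) :
    insertInterval m g f h ∈ initiallyFullWithGap m (r + g) g := by
  obtain ⟨hf, hp⟩ := hf
  have h0' := fun x => matchingInvolutions.lt hh (x := x)
  refine ⟨⟨insertInterval_mem hf hr hh, ?_⟩, ?_, ?_⟩
  · intro i j hi hij hj hc
    refine hp i (if j ≤ m then j else if j ≤ m + g then m else j - g) (by omega) (by grind) (by grind) ?_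
    intro x hx1 hx2
    have a1 := hc x
    have a2 := hc (x + 2 * g)
    unfold insertInterval at a1 a2
    grind (splits := 25)
  · intro x h1 h2
    have := h0' (x - (2*m+1))
    unfold insertInterval
    grind
  · intro j hj1 hj2 hc
    refine hp m (j - g) (by omega) (by omega) (by omega) ?_
    intro x hx1 hx2
    have a2 := hc (x + 2 * g)
    unfold insertInterval at a2
    grind

theorem removeInterval_mem_initiallyFull {m g r f} (hf : f ∈ initiallyFullWithGap m (r + g) g) (hr : m + 1 ≤ r) : removeInterval m g f ∈ initiallyFull (m+1) r := by
  obtain ⟨⟨hf, hp⟩, hc, hm⟩ := hf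
  refine ⟨removeInterval_mem hf hr hc, ?_⟩
  intro i j hi hij hj hd
  have h4 := StableOn.not_mem_of_not_mem hf hc
  by_cases him : i = m
  · subst him
    refine hm (j + g) (by omega) (by omega) ?_
    intro x hx1 hx2
    have a1 := hd (x - 2 * g)
    have a2 := hc x
    have a3 := h4 x
    unfold removeInterval at a1
    grind
  · by_cases hjm : j ≤ m
    · refine hp i j (by omega) (by omega) (by omega) ?_
      intro x hx1 hx2
      have a1 := hd x
      have a3 := h4 x
      unfold removeInterval at a1
      grind
    · refine hp i (j + g) (by omega) (by omega) (by omega) ?_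
      intro x hx1 hx2
      have a1 := hd x
      have a1' := hd (x - 2 * g)
      have a2 := hc x
      have a3 := h4 x
      unfold removeInterval at a1 a1'
      rcases lt_or_ge x (2*m+1) with h5 | h5
      · clear a1'
        simp only [h5, if_true] at a1
        split_ifs at a1 <;> omega
      · rcases lt_or_ge x (2*(m+g)+1) with h6 | h6
        · omega
        · clear a1
          rw [if_neg (show ¬ x - 2 * g < 2 * m + 1 by omega),
            Nat.sub_add_cancel (show 2 * g ≤ x by omega)] at a1'
          split_ifs at a1' <;> omega

theorem ncard_initiallyFullWithGap {m g r} (hr : m + 1 ≤ r) : (initiallyFullWithGap m (r + g) g).ncard = (matchingInvolutions g).ncard * (initiallyFull (m+1) r).ncard := by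
  have : Set.BijOn (fun p : (ℕ → ℕ) × (ℕ → ℕ) => insertInterval m g p.2 p.1) (matchingInvolutions g ×ˢ initiallyFull (m+1) r) (initiallyFullWithGap m (r + g) g) := by
    refine ⟨fun p hp => insertInterval_mem_initiallyFullWithGap hp.2 hr hp.1, ?_, ?_⟩
    · rintro ⟨k, f⟩ ⟨hk, hf⟩ ⟨k', f'⟩ ⟨hk', hf'⟩ h
      simp only at h hk hk'
      have e : f = f' := by rw [← removeInterval_insertInterval m g f k, h, removeInterval_insertInterval]
      have e' : k = k' := by rw [← restrictInterval_insertInterval (m := m) (f := f) hk, h, restrictInterval_insertInterval hk']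
      rw [e, e']
    · intro f hf
      exact ⟨(restrictInterval m g f, removeInterval m g f), ⟨restrictInterval_mem hf.1.1 hr hf.2.1, removeInterval_mem_initiallyFull hf hr⟩, insertInterval_remove_restrict hf.1.1 hf.2.1⟩
  rw [← this.image_eq, this.injOn.ncard_image, Set.ncard_prod]

theorem ncard_initiallyFull {m r : ℕ} : (initiallyFull m (m + 1 + r)).ncard =
    ∑ p ∈ Finset.HasAntidiagonal.antidiagonal r, (matchingInvolutions p.1).ncard * (initiallyFull (m+1) (m + 1 + p.2)).ncard := by
  have e : initiallyFull m (m+1+r) = ⋃ p ∈ Finset.HasAntidiagonal.antidiagonal r, initiallyFullWithGap m (m+1+r) p.1 := by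
    ext f
    simp only [Set.mem_iUnion, exists_prop]
    constructor
    · intro hf
      classical
      have h0 : (fun g => StableOn f (2*m+1) (2*(m+g)+1)) 0 := by intro x h1 h2; omega
      have h1 := Nat.findGreatest_spec (P := fun g => StableOn f (2*m+1) (2*(m+g)+1)) (Nat.zero_le r) h0
      have h2 := Nat.findGreatest_le (P := fun g => StableOn f (2*m+1) (2*(m+g)+1)) r
      refine ⟨(_, r - Nat.findGreatest (fun g => StableOn f (2*m+1) (2*(m+g)+1)) r), ?_, hf, h1, ?_⟩
      · simp; omega
      · intro j hj1 hj2 hc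
        refine Nat.findGreatest_is_greatest (P := fun g => StableOn f (2*m+1) (2*(m+g)+1)) (k := j - m) (n := r) (by omega) (by omega) ?_
        rwa [show m + (j - m) = j by omega]
    · rintro ⟨p, _, h⟩
      exact h.1
  have hfin : ∀ n g, (initiallyFullWithGap m n g).Finite := fun n g => (matchingInvolutions_finite n).subset fun f hf => hf.1.1
  rw [e, show (⋃ p ∈ Finset.HasAntidiagonal.antidiagonal r, initiallyFullWithGap m (m+1+r) p.1) =
    ⋃ p ∈ (↑(Finset.HasAntidiagonal.antidiagonal r) : Set (ℕ × ℕ)), initiallyFullWithGap m (m+1+r) p.1 by simp,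
    Set.Finite.ncard_biUnion (Finset.finite_toSet _) (fun p _ => hfin _ _), finsum_mem_coe_finset]
  · refine Finset.sum_congr rfl fun p hp => ?_
    rw [Finset.HasAntidiagonal.mem_antidiagonal] at hp
    rw [← ncard_initiallyFullWithGap (by omega), add_assoc (m + 1), add_comm p.2, hp]
  · have key : ∀ p q : ℕ, p < q → q ≤ r → ∀ f ∈ initiallyFullWithGap m (m+1+r) p, f ∉ initiallyFullWithGap m (m+1+r) q := by
      intro p q hpq hq f hf hf'
      exact hf.2.2 (m + q) (by omega) (by omega) hf'.2.1
    intro p hp q hq hpq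
    have hp' := Finset.HasAntidiagonal.mem_antidiagonal.1 hp
    have hq' := Finset.HasAntidiagonal.mem_antidiagonal.1 hq
    refine Set.disjoint_left.2 fun f hf hf' => ?_
    rcases lt_trichotomy p.1 q.1 with h | h | h
    · exact key _ _ h (by omega) f hf hf'
    · exact hpq (Prod.ext h (by omega))
    · exact key _ _ h (by omega) f hf' hf

/-- The set of pairs `{x, f x}` of the matching encoded by `f`. -/
def toMatching (n : ℕ) (f : ℕ → ℕ) : Finset (Finset ℕ) := (Finset.range (2 * n)).image fun x => {x, f x}

theorem mem_toMatching {n : ℕ} {f : ℕ → ℕ} {p : Finset ℕ} : p ∈ toMatching n f ↔ ∃ x < 2 * n, {x, f x} = p := by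
  simp [toMatching]

theorem toMatching_isPerfectMatching {n f} (hf : f ∈ matchingInvolutions n) : IsPerfectMatching n (toMatching n f) := by
  have h0 := fun x => matchingInvolutions.lt hf (x := x)
  obtain ⟨h1, h2⟩ := hf
  refine ⟨?_, ?_, ?_, ?_⟩
  · intro p hp
    obtain ⟨x, hx, rfl⟩ := mem_toMatching.1 hp
    have := h2 x
    exact Finset.card_pair (by omega)
  · intro p hp y hy
    obtain ⟨x, hx, rfl⟩ := mem_toMatching.1 hp
    have := h0 x
    grind
  · intro p hp q hq hpq
    obtain ⟨x, hx, rfl⟩ := mem_toMatching.1 hp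
    obtain ⟨y, hy, rfl⟩ := mem_toMatching.1 hq
    rw [Finset.disjoint_left]
    intro z hz hz'
    apply hpq
    have := h1 x
    have := h1 y
    simp only [Finset.mem_insert, Finset.mem_singleton] at hz hz'
    ext w
    simp only [Finset.mem_insert, Finset.mem_singleton]
    grind
  · intro x hx
    exact ⟨_, mem_toMatching.2 ⟨x, hx, rfl⟩, by simp⟩

theorem toMatching_injOn (n : ℕ) : Set.InjOn (toMatching n) (matchingInvolutions n) := by
  intro f hf g hg h
  funext x
  by_cases hx : x < 2 * n
  · have : ({x, f x} : Finset ℕ) ∈ toMatching n g := h ▸ mem_toMatching.2 ⟨x, hx, rfl⟩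
    obtain ⟨y, hy, e⟩ := mem_toMatching.1 this
    have e1 : f x ∈ ({y, g y} : Finset ℕ) := by rw [e]; simp
    have e2 : x ∈ ({y, g y} : Finset ℕ) := by rw [e]; simp
    have := hf.2 x
    have := hg.1 y
    simp only [Finset.mem_insert, Finset.mem_singleton] at e1 e2
    grind
  · rw [(hf.2 x).2 (by omega), (hg.2 x).2 (by omega)]

theorem exists_toMatching {n M} (hM : IsPerfectMatching n M) : ∃ f ∈ matchingInvolutions n, toMatching n f = M := by
  obtain ⟨hc, hb, hd, hcov⟩ := hM
  have : ∀ x, ∃ y, (x < 2 * n → y ≠ x ∧ {x, y} ∈ M) ∧ (2 * n ≤ x → y = x) := by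
    intro x
    by_cases hx : x < 2 * n
    · obtain ⟨p, hp, hxp⟩ := hcov x hx
      obtain ⟨a, b, hab, rfl⟩ := Finset.card_eq_two.1 (hc p hp)
      simp only [Finset.mem_insert, Finset.mem_singleton] at hxp
      rcases hxp with rfl | rfl
      · exact ⟨b, fun _ => ⟨hab.symm, hp⟩, fun h => by omega⟩
      · exact ⟨a, fun _ => ⟨hab, by rwa [Finset.pair_comm]⟩, fun h => by omega⟩
    · exact ⟨x, fun h => absurd h hx, fun _ => rfl⟩
  choose f hf1 hf2 using this
  have heq : ∀ p ∈ M, ∀ q ∈ M, ∀ x, x ∈ p → x ∈ q → p = q := by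
    intro p hp q hq x hxp hxq
    by_contra hne
    exact Finset.disjoint_left.1 (hd p hp q hq hne) hxp hxq
  refine ⟨f, ⟨fun x => ?_, fun x => ⟨fun h => ?_, hf2 x⟩⟩, ?_⟩
  · by_cases hx : x < 2 * n
    · obtain ⟨h1, h2⟩ := hf1 x hx
      obtain ⟨h3, h4⟩ := hf1 (f x) (hb _ h2 _ (by simp))
      have e := heq _ h2 _ h4 (f x) (by simp) (by simp)
      have : x ∈ ({f x, f (f x)} : Finset ℕ) := by rw [← e]; simp
      simp only [Finset.mem_insert, Finset.mem_singleton] at this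
      grind
    · rw [hf2 x (by omega), hf2 x (by omega)]
  · by_contra hx
    exact (hf1 x (by omega)).1 h
  · ext p
    rw [mem_toMatching]
    constructor
    · rintro ⟨x, hx, rfl⟩
      exact (hf1 x hx).2
    · intro hp
      obtain ⟨x, hx⟩ : p.Nonempty := by
        rw [← Finset.card_pos, hc p hp]; omega
      exact ⟨x, hb p hp x hx, heq _ (hf1 x (hb p hp x hx)).2 _ hp x (by simp) hx⟩

theorem card_pair_inter_ne_one {x y : ℕ} (h : x ≠ y) (s : Finset ℕ) :
    (({x, y} : Finset ℕ) ∩ s).card ≠ 1 ↔ (x ∈ s ↔ y ∈ s) := by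
  by_cases hx : x ∈ s <;> by_cases hy : y ∈ s <;>
    simp [Finset.insert_inter_of_mem, Finset.insert_inter_of_notMem, Finset.singleton_inter_of_mem,
      Finset.singleton_inter_of_notMem, hx, hy, h]

theorem isDividingLine_toMatching {n f} (hf : f ∈ matchingInvolutions n) (i j : ℕ) :
    IsDividingLine n (i + 1) (j + 1) (toMatching n f) ↔ i < j ∧ j + 1 ≤ n ∧ StableOn f (2*i+1) (2*j+1) := by
  have h0 := fun x => matchingInvolutions.lt hf (x := x)
  obtain ⟨h1, h2⟩ := hf
  unfold IsDividingLine StableOn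
  constructor
  · rintro ⟨-, hij, hj, h⟩
    refine ⟨by omega, hj, fun x hx1 hx2 => ?_⟩
    have := h _ (mem_toMatching.2 ⟨x, by omega, rfl⟩)
    have h3 := h2 x
    rw [card_pair_inter_ne_one (by omega), Finset.mem_Icc, Finset.mem_Icc] at this
    omega
  · rintro ⟨hij, hj, h⟩
    refine ⟨by omega, by omega, hj, fun p hp => ?_⟩
    obtain ⟨x, hx, rfl⟩ := mem_toMatching.1 hp
    have h3 := h2 x
    have h4 := h x
    have h5 := h (f x)
    rw [h1] at h5
    rw [card_pair_inter_ne_one (by omega), Finset.mem_Icc, Finset.mem_Icc]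
    omega

theorem isFull_toMatching {n f} (hf : f ∈ matchingInvolutions n) : IsFull n (toMatching n f) ↔ f ∈ initiallyFull (n - 1) n := by
  constructor
  · intro h
    refine ⟨hf, fun i j _ hij hj hc => h (i + 1) (j + 1) ((isDividingLine_toMatching hf i j).2 ⟨hij, hj, hc⟩)⟩
  · rintro ⟨_, h⟩ i j hd
    obtain ⟨h1, h2, h3, _⟩ := id hd
    obtain ⟨i, rfl⟩ := Nat.exists_eq_add_of_le' h1
    obtain ⟨j, rfl⟩ := Nat.exists_eq_add_of_le' (show 1 ≤ j by omega)
    have := (isDividingLine_toMatching hf i j).1 hd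
    exact h i j (by omega) this.1 this.2.1 this.2.2

theorem fullCount_eq (n : ℕ) : fullCount n = (initiallyFull (n - 1) n).ncard := by
  have : Set.BijOn (toMatching n) (initiallyFull (n - 1) n) {M | IsPerfectMatching n M ∧ IsFull n M} := by
    refine ⟨fun f hf => ⟨toMatching_isPerfectMatching hf.1, (isFull_toMatching hf.1).2 hf⟩,
      (toMatching_injOn n).mono fun f hf => hf.1, ?_⟩
    rintro M ⟨hM, hfull⟩
    obtain ⟨f, hf, rfl⟩ := exists_toMatching hM
    exact ⟨f, (isFull_toMatching hf).1 hfull, rfl⟩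
  rw [fullCount, ← this.image_eq, this.injOn.ncard_image]

theorem initiallyFull_zero (n : ℕ) : initiallyFull 0 n = matchingInvolutions n := by
  ext f
  simp [initiallyFull]

theorem initiallyFull_self (n : ℕ) : initiallyFull n n = initiallyFull (n - 1) n := by
  ext f
  constructor
  · exact fun h => ⟨h.1, fun i j hi => h.2 i j (by omega)⟩
  · exact fun h => ⟨h.1, fun i j hi hij hj => h.2 i j (by omega) hij hj⟩

open PowerSeries in
theorem derivative_matchingSeries {A : PowerSeries ℚ} (hA : A = mk fun n => ((matchingInvolutions n).ncard : ℚ)) :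
    A = 1 + X * A + 2 * X ^ 2 * d⁄dX ℚ A := by
  ext n
  rcases n with _ | n
  · simp [hA, ncard_matchingInvolutions_zero]
  · rw [show 1 + X * A + 2 * X ^ 2 * d⁄dX ℚ A = 1 + X * (A + C 2 * (X * d⁄dX ℚ A)) by
      rw [show (C 2 : PowerSeries ℚ) = 2 from map_ofNat C 2]; ring]
    rw [map_add, coeff_succ_X_mul, map_add, coeff_C_mul]
    rcases n with _ | n
    · simp [hA, ncard_matchingInvolutions_succ, coeff_one]
    · rw [coeff_succ_X_mul, coeff_derivative, hA]
      simp only [coeff_mk, coeff_one]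
      rw [ncard_matchingInvolutions_succ (n + 1)]
      push_cast
      simp
      ring

open PowerSeries in
theorem matchingSeries_eq_subst {A : PowerSeries ℚ} (hA : A = mk fun n => ((matchingInvolutions n).ncard : ℚ)) :
    A = (mk fun n => (fullCount n : ℚ)).subst (X * A) := by
  have hs : HasSubst (X * A) := HasSubst.of_constantCoeff_zero' (by simp)
  set R : ℕ → PowerSeries ℚ := fun m => mk fun s => ((initiallyFull m (m + s)).ncard : ℚ) with hR
  set T : ℕ → PowerSeries ℚ := fun m => mk fun s => (fullCount (m + s) : ℚ) with hT
  have hR0 : R 0 = A := by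
    ext n
    simp [hR, hA, initiallyFull_zero]
  have hRm : ∀ m, R m = C (fullCount m : ℚ) + X * A * R (m + 1) := by
    intro m
    ext s
    rw [mul_assoc]
    rcases s with _ | s
    · simp [hR, fullCount_eq, initiallyFull_self]
    · rw [map_add, coeff_succ_X_mul, coeff_mul]
      simp only [hR, hA, coeff_mk, coeff_C]
      rw [show m + (s + 1) = m + 1 + s by omega, ncard_initiallyFull]
      push_cast
      simp
  have hTm : ∀ m, (T m).subst (X * A) = C (fullCount m : ℚ) + X * A * (T (m + 1)).subst (X * A) := by
    intro m
    have : T m = C (fullCount m : ℚ) + X * T (m + 1) := by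
      ext s
      rcases s with _ | s
      · simp [hT]
      · rw [map_add, coeff_succ_X_mul]
        simp only [hT, coeff_mk, coeff_C]
        rw [show m + (s + 1) = m + 1 + s by omega]
        simp
    rw [this, subst_add hs, subst_mul hs, subst_X hs, subst_C]
    rfl
  have key : ∀ K, R 0 - (T 0).subst (X * A) = (X * A) ^ K * (R K - (T K).subst (X * A)) := by
    intro K
    induction K with
    | zero => simp
    | succ K ih => rw [ih, hRm K, hTm K]; ring
  have h0 : R 0 - (T 0).subst (X * A) = 0 := by
    ext n
    have : X ^ (n + 1) ∣ R 0 - (T 0).subst (X * A) := by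
      rw [key (n + 1), mul_pow, mul_assoc]
      exact dvd_mul_right _ _
    exact X_pow_dvd_iff.1 this n (Nat.lt_succ_self n)
  rw [hR0, sub_eq_zero] at h0
  simpa [hT] using h0

open PowerSeries in
theorem fullSeries_equation {F : PowerSeries ℚ} (hF : F = mk fun n => (fullCount n : ℚ)) :
    (F - 1 - X) * (F - X * d⁄dX ℚ F) = 2 * (X * (X * d⁄dX ℚ F)) := by
  obtain ⟨A, hA⟩ : ∃ A : PowerSeries ℚ, A = mk fun n => ((matchingInvolutions n).ncard : ℚ) := ⟨_, rfl⟩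
  have hs : HasSubst (X * A) := HasSubst.of_constantCoeff_zero' (by simp)
  have h1 := derivative_matchingSeries hA
  have h2 := matchingSeries_eq_subst hA
  rw [← hF] at h2
  have h3 : d⁄dX ℚ A = (d⁄dX ℚ F).subst (X * A) * (A + X * d⁄dX ℚ A) := by
    conv_lhs => rw [h2, derivative_subst hs]
    rw [Derivation.leibniz, derivative_X]
    simp only [smul_eq_mul]
    ring
  set c := (d⁄dX ℚ F).subst (X * A) with hc
  have h4 : ((F - 1 - X) * (F - X * d⁄dX ℚ F) - 2 * (X * (X * d⁄dX ℚ F))).subst (X * A) = (0 : PowerSeries ℚ) := by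
    rw [show (2 : PowerSeries ℚ) = C 2 from (map_ofNat C 2).symm, show (1 : PowerSeries ℚ) = C 1 by simp]
    simp only [subst_sub hs, subst_mul hs, subst_X hs, subst_C]
    rw [← hc, ← h2]
    change (A - C 1 - X * A) * (A - X * A * c) - C 2 * (X * A * (X * A * c)) = 0
    rw [show (C 2 : PowerSeries ℚ) = 2 from map_ofNat C 2, show (C 1 : PowerSeries ℚ) = 1 by simp]
    linear_combination (A - X * A * c) * h1 + 2 * X ^ 2 * A * h3
  have h5 : IsUnit (coeff 1 (X * A)) := by
    rw [show 1 = 0 + 1 from rfl, coeff_succ_X_mul, hA]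
    simp [ncard_matchingInvolutions_zero]
  rw [← sub_eq_zero]
  set E := (F - 1 - X) * (F - X * d⁄dX ℚ F) - 2 * (X * (X * d⁄dX ℚ F))
  have h6 := subst_substInvOfIsUnit_right (X * A) (by simp) h5
  have hi := HasSubst.substInvOfIsUnit (X * A) h5
  rw [← X_subst E, ← h6, ← subst_comp_subst_apply hs hi, h4, ← map_zero (C (R := ℚ)), subst_C]
  rfl

theorem fullCount_zero : fullCount 0 = 1 := by
  rw [fullCount_eq, initiallyFull_zero, ncard_matchingInvolutions_zero]

theorem fullCount_one : fullCount 1 = 1 := by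
  rw [fullCount_eq, initiallyFull_zero, ncard_matchingInvolutions_succ, ncard_matchingInvolutions_zero]

open PowerSeries in
theorem fullCount_antidiagonal_sum (n : ℕ) (hn : 2 ≤ n) :
    ∑ p ∈ Finset.HasAntidiagonal.antidiagonal n,
      (1 - (p.1 : ℚ)) * fullCount p.1 * (if p.2 < 2 then 0 else (fullCount p.2 : ℚ)) =
    2 * (n - 1) * fullCount (n - 1) := by
  have h := congrArg (coeff n) (fullSeries_equation rfl)
  set F : PowerSeries ℚ := mk fun n => (fullCount n : ℚ) with hF
  have hD : ∀ k : ℕ, PowerSeries.coeff (R := ℚ) k (X * d⁄dX ℚ F) = k * fullCount k := by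
    intro k
    rcases k with _ | k
    · simp
    · rw [coeff_succ_X_mul, coeff_derivative, hF, coeff_mk]
      push_cast; ring
  obtain ⟨n, rfl⟩ := Nat.exists_eq_add_of_le' (show 1 ≤ n by omega)
  rw [← map_ofNat C 2, coeff_C_mul, coeff_succ_X_mul, hD, mul_comm (F - 1 - X), coeff_mul] at h
  rw [Nat.add_sub_cancel]
  push_cast
  rw [add_sub_cancel_right, mul_assoc, ← h]
  refine Finset.sum_congr rfl fun p _ => ?_
  rw [map_sub _ F, hD, map_sub, map_sub, hF, coeff_mk, coeff_mk, coeff_one, coeff_X]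
  congr 1
  · ring
  · rcases p.2 with _ | _ | k
    · simp [fullCount_zero]
    · simp [fullCount_one]
    · simp

/-- `F_1 = 1` and, for every `n ≥ 2`,
`F_n = 2(n-1) F_{n-1} + ∑_{j=2}^{n-2} (j-1) F_j F_{n-j}` (the sum being empty for `n ≤ 3`). -/
theorem fullCount_recurrence :
    fullCount 1 = 1 ∧
      ∀ n : ℕ, 2 ≤ n →
        fullCount n = 2 * (n - 1) * fullCount (n - 1) +
          ∑ j ∈ Finset.Icc 2 (n - 2), (j - 1) * fullCount j * fullCount (n - j) := by
  refine ⟨fullCount_one, fun n hn => ?_⟩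
  have h := fullCount_antidiagonal_sum n hn
  obtain ⟨n, rfl⟩ := Nat.exists_eq_add_of_le' hn
  rw [Finset.Nat.sum_antidiagonal_eq_sum_range_succ
    fun i j => (1 - (i : ℚ)) * fullCount i * (if j < 2 then 0 else (fullCount j : ℚ))] at h
  rcases n with _ | k
  · simp [Finset.sum_range_succ, fullCount_one, fullCount_zero] at h ⊢
    norm_num at h
    exact_mod_cast h
  rw [Finset.sum_range_succ, Finset.sum_range_succ, Finset.sum_range_succ',
    Finset.sum_range_succ'] at h
  have e : ∑ j ∈ Finset.Icc 2 (k + 1 + 2 - 2), (j - 1) * fullCount j * fullCount (k + 1 + 2 - j) =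
      ∑ x ∈ Finset.range k, (x + 1) * fullCount (x + 2) * fullCount (k + 1 - x) := by
    rw [← Finset.Ico_succ_right_eq_Icc, Finset.sum_Ico_eq_sum_range]
    refine Finset.sum_congr (by simp) fun x _ => ?_
    rw [show 2 + x - 1 = x + 1 by omega, show k + 1 + 2 - (2 + x) = k + 1 - x by omega, add_comm 2 x]
  have e2 : ∀ x ∈ Finset.range k, (1 - ((x + 1 + 1 : ℕ) : ℚ)) * fullCount (x + 1 + 1) *
        (if k + 1 + 2 - (x + 1 + 1) < 2 then 0 else (fullCount (k + 1 + 2 - (x + 1 + 1)) : ℚ)) =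
      -(((x + 1) * fullCount (x + 2) * fullCount (k + 1 - x) : ℕ) : ℚ) := by
    intro x hx
    rw [Finset.mem_range] at hx
    rw [if_neg (by omega), show k + 1 + 2 - (x + 1 + 1) = k + 1 - x by omega]
    push_cast
    ring
  rw [Finset.sum_congr rfl e2, Finset.sum_neg_distrib, ← Nat.cast_sum, ← e] at h
  have h1 : (k + 1 + 2 - (k + 1 + 1) : ℕ) < 2 := by omega
  simp only [h1, if_true, fullCount_zero, Nat.sub_self, Nat.sub_zero] at h
  have h3 : ((k + 1 + 2 - 1 : ℕ) : ℚ) = ((k + 1 + 2 : ℕ) : ℚ) - 1 := by push_cast; ring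
  rw [← h3] at h
  norm_num at h
  rw [← Nat.cast_inj (R := ℚ)]
  push_cast at h ⊢
  linarith
end

section
/- The limit of X_n/(2n−1)!! as n → ∞ exists and equals e^{−1/2}; that is, the density of full wiring diagrams among all wiring diagrams of order n tends to 1/√e. -/
/-- The sequence `X_n` counting equivalence classes of circular planar electrical networks:
`X_1 = 1` and, for `n ≥ 2`,
`X_n = 2(n-1) X_{n-1} + ∑_{j=2}^{n-2} (j-1) X_j X_{n-j}` (the sum being empty for `n ≤ 3`;
here it is written over the attached index set to establish termination). -/
def X : ℕ → ℕ
  | 0 => 1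
  | 1 => 1
  | n + 2 =>
      2 * (n + 1) * X (n + 1) +
        ∑ j ∈ (Finset.Icc 2 n).attach, (j.1 - 1) * X j.1 * X (n + 2 - j.1)
decreasing_by
  · exact Nat.lt_succ_self (n + 1)
  · have := j.2; rw [Finset.mem_Icc] at this; omega
  · have := j.2; rw [Finset.mem_Icc] at this; omega

theorem X_zero : X 0 = 1 := by rw [X]

theorem X_one : X 1 = 1 := by rw [X]

theorem X_two : X 2 = 2 := by simp [X]

open PowerSeries hiding X
open scoped PowerSeries

/-- The generating function of the sequence `X`. -/
noncomputable def networkSeries : PowerSeries ℝ := PowerSeries.mk fun n => (X n : ℝ)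

/-- The double factorials `(2n-1)!!`, as real numbers. -/
noncomputable def oddDoubleFactorial (n : ℕ) : ℝ := (Nat.doubleFactorial (2 * n - 1) : ℝ)

/-- The generating function of the double factorials `(2n-1)!!`. -/
noncomputable def wiringSeries : PowerSeries ℝ := PowerSeries.mk oddDoubleFactorial

theorem oddDoubleFactorial_zero : oddDoubleFactorial 0 = 1 := by
  simp [oddDoubleFactorial, Nat.doubleFactorial]

theorem oddDoubleFactorial_succ (n : ℕ) :
    oddDoubleFactorial (n + 1) = (2 * n + 1) * oddDoubleFactorial n := by
  have h : 2 * (n + 1) - 1 = 2 * n + 1 := by omega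
  rw [oddDoubleFactorial, oddDoubleFactorial, h, Nat.doubleFactorial_add_one]
  push_cast
  ring

theorem oddDoubleFactorial_pos (n : ℕ) : 0 < oddDoubleFactorial n :=
  Nat.cast_pos.2 (Nat.doubleFactorial_pos _)

theorem constantCoeff_networkSeries : PowerSeries.constantCoeff networkSeries = 1 := by
  simp [networkSeries, ← PowerSeries.coeff_zero_eq_constantCoeff_apply, X]

theorem constantCoeff_wiringSeries : PowerSeries.constantCoeff wiringSeries = 1 := by
  simp [wiringSeries, ← PowerSeries.coeff_zero_eq_constantCoeff_apply, oddDoubleFactorial_zero]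

theorem X_add_three (n : ℕ) :
    X (n + 3) = 2 * (n + 2) * X (n + 2) +
      ∑ i ∈ Finset.range n, (i + 1) * X (i + 2) * X (n + 1 - i) := by
  rw [X, Finset.sum_attach (Finset.Icc 2 (n + 1)) fun j => (j - 1) * X j * X (n + 1 + 2 - j)]
  congr 1
  change ∑ j ∈ Finset.Ico 2 (n + 2), _ = _
  rw [Finset.sum_Ico_eq_sum_range]
  refine Finset.sum_congr (by simp) fun i _ => ?_
  rw [show 2 + i - 1 = i + 1 by omega, show 2 + i = i + 2 by omega,
    show n + 1 + 2 - (i + 2) = n + 1 - i by omega]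

theorem networkSeries_differentialEquation :
    (PowerSeries.X * d⁄dX ℝ networkSeries - networkSeries) * (networkSeries - 1) =
      -(PowerSeries.X * (networkSeries + PowerSeries.X * d⁄dX ℝ networkSeries)) := by
  have hE : ∀ n, coeff n (PowerSeries.X * d⁄dX ℝ networkSeries) = n * (X n : ℝ) := by
    rintro (_ | n)
    · simp
    · simp [coeff_succ_X_mul, coeff_derivative, networkSeries, mul_comm]
  have hF : ∀ n, coeff n networkSeries = (X n : ℝ) := fun n => coeff_mk _ _
  ext n
  rw [mul_sub, mul_one, map_sub, coeff_mul, map_neg,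
    Finset.Nat.sum_antidiagonal_eq_sum_range_succ_mk]
  simp only [map_sub, hE, hF]
  rcases n with _ | _ | _ | n
  · simp [X_zero]
  · rw [coeff_succ_X_mul, map_add, hE, hF]
    simp [Finset.sum_range_succ, X_zero, X_one]
  · rw [coeff_succ_X_mul, map_add, hE, hF]
    simp [Finset.sum_range_succ, X_zero, X_one, X_two]
    norm_num
  · rw [coeff_succ_X_mul, map_add, hE, hF, Finset.sum_range_succ, Finset.sum_range_succ,
      Finset.sum_range_succ', Finset.sum_range_succ']
    have h : ∀ i ∈ Finset.range n,
        (((i + 1 + 1 : ℕ) : ℝ) * X (i + 1 + 1) - X (i + 1 + 1)) * X (n + 1 + 1 + 1 - (i + 1 + 1)) =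
          ((i + 1) * X (i + 2) * X (n + 1 - i) : ℕ) := by
      intro i _
      rw [show n + 1 + 1 + 1 - (i + 1 + 1) = n + 1 - i by omega]
      push_cast
      ring
    have hX := congrArg (Nat.cast : ℕ → ℝ) (X_add_three n)
    rw [Finset.sum_congr rfl h]
    simp [X_zero, X_one] at hX ⊢
    linear_combination -hX

theorem wiringSeries_differentialEquation :
    wiringSeries = 1 + PowerSeries.X * wiringSeries +
      2 * PowerSeries.X ^ 2 * d⁄dX ℝ wiringSeries := by
  have h2 : (2 : PowerSeries ℝ) = C 2 := (map_ofNat C 2).symm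
  ext n
  rw [h2, mul_assoc]
  rcases n with _ | _ | n
  · simp [constantCoeff_wiringSeries]
  · rw [pow_two, mul_assoc]
    simp [coeff_succ_X_mul, coeff_one, wiringSeries, oddDoubleFactorial_zero,
      oddDoubleFactorial_succ]
  · simp [pow_two, mul_assoc, coeff_succ_X_mul, coeff_one, coeff_derivative, wiringSeries]
    rw [oddDoubleFactorial_succ (n + 1)]
    push_cast
    ring

theorem eq_zero_of_eq_X_sq_mul_derivative {R : Type*} [CommRing R] {K W : PowerSeries R}
    (h : K = PowerSeries.X ^ 2 * W * d⁄dX R K) : K = 0 := by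
  have key : ∀ n : ℕ, PowerSeries.X ^ n ∣ K := by
    intro n
    induction n with
    | zero => simp
    | succ n ih =>
      obtain ⟨Q, hQ⟩ := ih
      rw [h]
      rcases n with _ | n
      · exact ⟨PowerSeries.X * W * d⁄dX R K, by ring⟩
      · refine ⟨W * (((n : PowerSeries R) + 1) * Q + PowerSeries.X * d⁄dX R Q), ?_⟩
        rw [hQ]
        simp [Derivation.leibniz]
        ring
  ext n
  exact X_pow_dvd_iff.1 (key (n + 1)) n n.lt_succ_self

theorem hasSubst_X_mul_wiringSeries : HasSubst (PowerSeries.X * wiringSeries) :=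
  HasSubst.of_constantCoeff_zero' (by simp)

theorem networkSeries_subst :
    networkSeries.subst (PowerSeries.X * wiringSeries) = wiringSeries := by
  have hg := hasSubst_X_mul_wiringSeries
  have hode := congrArg (PowerSeries.subst (PowerSeries.X * wiringSeries))
    networkSeries_differentialEquation
  have h1 : (1 : PowerSeries ℝ).subst (PowerSeries.X * wiringSeries) = 1 := by
    rw [← coe_substAlgHom hg, map_one]
  have hneg : ∀ f : PowerSeries ℝ, (-f).subst (PowerSeries.X * wiringSeries) =
      -f.subst (PowerSeries.X * wiringSeries) := fun f => by
    rw [← coe_substAlgHom hg, map_neg]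
  rw [hneg] at hode
  simp only [subst_mul hg, subst_sub hg, subst_add hg, subst_X hg, h1] at hode
  have hchain := derivative_subst (f := networkSeries) hg
  have hD := wiringSeries_differentialEquation
  have hg' : d⁄dX ℝ (PowerSeries.X * wiringSeries) =
      wiringSeries + PowerSeries.X * d⁄dX ℝ wiringSeries := by
    simp [add_comm]
  obtain ⟨Q, hQ⟩ : PowerSeries.X ∣ networkSeries.subst (PowerSeries.X * wiringSeries) - 1 := by
    obtain ⟨P, hP⟩ : PowerSeries.X ∣ networkSeries - 1 := by
      rw [X_dvd_iff]
      simp [constantCoeff_networkSeries]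
    rw [← h1, ← subst_sub hg, hP, subst_mul hg, subst_X hg, mul_assoc]
    exact dvd_mul_right _ _
  rw [hg'] at hchain
  have hD0 := constantCoeff_wiringSeries
  generalize networkSeries.subst (PowerSeries.X * wiringSeries) = H at *
  generalize (d⁄dX ℝ networkSeries).subst (PowerSeries.X * wiringSeries) = F' at *
  generalize wiringSeries = D at *
  have hK' : d⁄dX ℝ (H - D) = d⁄dX ℝ H - d⁄dX ℝ D := map_sub _ _ _
  generalize d⁄dX ℝ H = H' at *
  generalize d⁄dX ℝ D = D' at *
  have hdiff : (H - D) * ((D + PowerSeries.X * D') * (H + D - 1 - PowerSeries.X * D) -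
      PowerSeries.X * D * D') =
      PowerSeries.X * D * (H' - D') * (H - 1 + PowerSeries.X * D) := by
    linear_combination -(D + PowerSeries.X * D') * hode
      - PowerSeries.X * D * (H - 1 + PowerSeries.X * D) * hchain
      - (D * (D + PowerSeries.X * D') - PowerSeries.X * D * D') * hD
  obtain ⟨U, hU⟩ : IsUnit ((D + PowerSeries.X * D') * (H + D - 1 - PowerSeries.X * D) -
      PowerSeries.X * D * D') := by
    rw [isUnit_iff_constantCoeff]
    simp [hD0, eq_add_of_sub_eq hQ]
  rw [← hU, ← Units.eq_mul_inv_iff_mul_eq] at hdiff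
  refine sub_eq_zero.1 (eq_zero_of_eq_X_sq_mul_derivative (W := D * (Q + D) * ↑U⁻¹) ?_)
  rw [hK', hdiff, hQ]
  ring

/-- The coefficient of `u ^ m` in the `k`-th power of `wiringSeries`. -/
noncomputable def wiringPowCoeff (k m : ℕ) : ℝ := coeff m (wiringSeries ^ k)

theorem oddDoubleFactorial_eq_sum (n : ℕ) :
    oddDoubleFactorial n =
      ∑ k ∈ Finset.range (n + 1), (X k : ℝ) * wiringPowCoeff k (n - k) := by
  have h := congrArg (coeff n) networkSeries_subst
  rw [coeff_subst' hasSubst_X_mul_wiringSeries,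
    finsum_eq_sum_of_support_subset (s := Finset.range (n + 1))] at h
  · rw [wiringSeries, coeff_mk] at h
    rw [← h]
    refine Finset.sum_congr rfl fun k hk => ?_
    rw [← wiringSeries, mul_pow, coeff_X_pow_mul', if_pos (Finset.mem_range_succ_iff.1 hk),
      networkSeries, coeff_mk, smul_eq_mul, wiringPowCoeff]
  · intro k hk
    by_contra hkn
    refine hk ?_
    simp only [Finset.coe_range, Set.mem_Iio] at hkn
    change _ • coeff n ((PowerSeries.X * wiringSeries) ^ k) = 0
    rw [mul_pow, coeff_X_pow_mul', if_neg (by omega), smul_zero]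

theorem wiringPowCoeff_zero_right (k : ℕ) : wiringPowCoeff k 0 = 1 := by
  simp [wiringPowCoeff, constantCoeff_wiringSeries]

theorem wiringPowCoeff_zero_succ (m : ℕ) : wiringPowCoeff 0 (m + 1) = 0 := by
  simp [wiringPowCoeff, coeff_one]

theorem wiringPowCoeff_one (m : ℕ) : wiringPowCoeff 1 m = oddDoubleFactorial m := by
  simp [wiringPowCoeff, wiringSeries]

theorem wiringPowCoeff_succ_succ (k m : ℕ) :
    wiringPowCoeff (k + 1) (m + 1) = wiringPowCoeff k (m + 1) +
      (1 + 2 * m / (k + 1)) * wiringPowCoeff (k + 1) m := by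
  have hD := wiringSeries_differentialEquation
  have h : C (2 : ℝ) * (PowerSeries.X * (PowerSeries.X * d⁄dX ℝ (wiringSeries ^ (k + 1)))) =
      C ((k : ℝ) + 1) * (wiringSeries ^ (k + 1) - PowerSeries.X * wiringSeries ^ (k + 1) -
        wiringSeries ^ k) := by
    rw [derivative_pow, map_ofNat, map_add, map_one, map_natCast]
    rw [Nat.add_sub_cancel]
    push_cast
    linear_combination -((k : PowerSeries ℝ) + 1) * wiringSeries ^ k * hD
  have hc := congrArg (coeff (m + 1)) h
  rw [coeff_C_mul, coeff_C_mul, map_sub, map_sub, coeff_succ_X_mul, coeff_succ_X_mul] at hc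
  have hd : coeff m (PowerSeries.X * d⁄dX ℝ (wiringSeries ^ (k + 1))) =
      m * wiringPowCoeff (k + 1) m := by
    rcases m with _ | m
    · simp
    · rw [coeff_succ_X_mul, coeff_derivative, wiringPowCoeff]
      push_cast
      ring
  rw [hd] at hc
  simp only [wiringPowCoeff] at hc ⊢
  field_simp
  linear_combination -hc

theorem wiringPowCoeff_nonneg (k m : ℕ) : 0 ≤ wiringPowCoeff k m := by
  induction m generalizing k with
  | zero => simp [wiringPowCoeff_zero_right]
  | succ m ihm =>
    induction k with
    | zero => simp [wiringPowCoeff_zero_succ]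
    | succ k ihk =>
      rw [wiringPowCoeff_succ_succ]
      have := ihm (k + 1)
      positivity

theorem add_one_pow_succ_le {x : ℝ} (hx : 0 ≤ x) (m : ℕ) :
    (x + 1) ^ (m + 1) ≤ x ^ (m + 1) + (m + 1) * (x + 1) ^ m := by
  induction m with
  | zero => simp
  | succ m ih =>
    have h := mul_le_mul_of_nonneg_left ih hx
    have h' : 0 ≤ ((m : ℝ) + 1) * (x + 1) ^ m := by positivity
    push_cast
    linear_combination h + h'

theorem le_add_one_pow_succ {x : ℝ} (hx : 0 ≤ x) (m : ℕ) :
    x ^ (m + 1) + (m + 1) * x ^ m ≤ (x + 1) ^ (m + 1) := by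
  induction m with
  | zero => simp
  | succ m ih =>
    have h := mul_le_mul_of_nonneg_left ih (by positivity : 0 ≤ x + 1)
    have h' : 0 ≤ ((m : ℝ) + 1) * x ^ m := by positivity
    push_cast
    linear_combination h + h'

theorem pow_div_factorial_le_wiringPowCoeff (k m : ℕ) :
    (k : ℝ) ^ m / m.factorial ≤ wiringPowCoeff k m := by
  induction m generalizing k with
  | zero => simp [wiringPowCoeff_zero_right]
  | succ m ihm =>
    induction k with
    | zero => simp [wiringPowCoeff_zero_succ]
    | succ k ihk =>
      have h0 := wiringPowCoeff_nonneg (k + 1) m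
      have h1 : 0 ≤ 2 * (m : ℝ) / (k + 1) * wiringPowCoeff (k + 1) m := by positivity
      have h2 : ((k + 1 : ℕ) : ℝ) ^ (m + 1) / (m + 1).factorial ≤
          (k : ℝ) ^ (m + 1) / (m + 1).factorial + ((k + 1 : ℕ) : ℝ) ^ m / m.factorial := by
        rw [Nat.factorial_succ]
        push_cast
        rw [← sub_nonneg]
        have h3 := div_nonneg (sub_nonneg.2 (add_one_pow_succ_le k.cast_nonneg m))
          (by positivity : (0 : ℝ) ≤ (m + 1) * m.factorial)
        convert! h3 using 1
        field_simp
      rw [wiringPowCoeff_succ_succ]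
      linarith [ihm (k + 1)]

theorem exists_wiringPowCoeff_le (m : ℕ) :
    ∃ s : ℝ, 0 ≤ s ∧ ∀ k : ℕ, wiringPowCoeff k m ≤ ((k : ℝ) + s) ^ m / m.factorial := by
  induction m with
  | zero => exact ⟨0, le_rfl, fun k => by simp [wiringPowCoeff_zero_right]⟩
  | succ m ih =>
    obtain ⟨s, hs, h⟩ := ih
    refine ⟨1 + s + 2 * m + 2 * m * s, by positivity, fun k => ?_⟩
    set t := 1 + s + 2 * m + 2 * m * s with ht
    have ht0 : 0 ≤ t := by positivity
    induction k with
    | zero =>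
      rw [wiringPowCoeff_zero_succ]
      positivity
    | succ k ihk =>
      have h1 : (1 + 2 * (m : ℝ) / (k + 1)) * (k + 1 + s) ^ m ≤ (k + t) ^ m := by
        rcases Nat.eq_zero_or_pos m with rfl | hm
        · simp
        have h2 : 1 + 2 * (m : ℝ) / (k + 1) ≤ (1 + 2 * (m : ℝ) / (k + 1)) ^ m :=
          le_self_pow₀ (le_add_of_nonneg_right (by positivity)) hm.ne'
        calc (1 + 2 * (m : ℝ) / (k + 1)) * (k + 1 + s) ^ m
            ≤ (1 + 2 * (m : ℝ) / (k + 1)) ^ m * (k + 1 + s) ^ m := by gcongr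
          _ = ((1 + 2 * (m : ℝ) / (k + 1)) * (k + 1 + s)) ^ m := (mul_pow _ _ _).symm
          _ ≤ (k + t) ^ m := by
            gcongr
            have h3 : (1 + 2 * (m : ℝ) / (k + 1)) * (k + 1 + s) =
                k + 1 + s + 2 * m + 2 * m * s / (k + 1) := by
              field_simp
              ring
            have h4 : 2 * m * s / ((k : ℝ) + 1) ≤ 2 * m * s :=
              div_le_self (by positivity) (by linarith [k.cast_nonneg (α := ℝ)])
            rw [h3, ht]
            linarith
      have h5 := le_add_one_pow_succ (by positivity : (0 : ℝ) ≤ k + t) m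
      have h6 : (1 + 2 * (m : ℝ) / (k + 1)) * wiringPowCoeff (k + 1) m ≤
          (k + t) ^ m / m.factorial := by
        refine (mul_le_mul_of_nonneg_left (h (k + 1)) (by positivity)).trans ?_
        rw [← mul_div_assoc]
        push_cast
        gcongr
      have h7 : ((k : ℝ) + t) ^ (m + 1) / (m + 1).factorial + (k + t) ^ m / m.factorial ≤
          (((k + 1 : ℕ) : ℝ) + t) ^ (m + 1) / (m + 1).factorial := by
        rw [Nat.factorial_succ]
        push_cast
        rw [← sub_nonneg]
        have h8 := div_nonneg (sub_nonneg.2 h5)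
          (by positivity : (0 : ℝ) ≤ (m + 1) * m.factorial)
        convert! h8 using 1
        field_simp
        ring
      rw [wiringPowCoeff_succ_succ]
      linarith

theorem tendsto_wiringPowCoeff_div_pow (m : ℕ) :
    Filter.Tendsto (fun k : ℕ => wiringPowCoeff k m / (k : ℝ) ^ m) Filter.atTop
      (nhds (1 / m.factorial)) := by
  obtain ⟨s, hs, h⟩ := exists_wiringPowCoeff_le m
  have hlim : Filter.Tendsto (fun k : ℕ => (1 + s / (k : ℝ)) ^ m / m.factorial) Filter.atTop
      (nhds (1 / m.factorial)) := by
    have := (((tendsto_const_div_atTop_nhds_zero_nat s).const_add 1).pow m).div_const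
      (m.factorial : ℝ)
    simpa using this
  refine tendsto_of_tendsto_of_tendsto_of_le_of_le' tendsto_const_nhds hlim ?_ ?_
  · filter_upwards [Filter.eventually_gt_atTop 0] with k hk
    have hk' : (0 : ℝ) < k := Nat.cast_pos.2 hk
    rw [le_div_iff₀ (by positivity), one_div_mul_eq_div]
    exact pow_div_factorial_le_wiringPowCoeff k m
  · filter_upwards [Filter.eventually_gt_atTop 0] with k hk
    have hk' : (0 : ℝ) < k := Nat.cast_pos.2 hk
    rw [div_le_iff₀ (by positivity), div_mul_eq_mul_div, ← mul_pow]
    refine (h k).trans_eq ?_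
    congr 2
    field_simp

theorem tendsto_oddDoubleFactorial_add_div (m : ℕ) :
    Filter.Tendsto (fun k : ℕ => oddDoubleFactorial (k + m) / oddDoubleFactorial k / (k : ℝ) ^ m)
      Filter.atTop (nhds (2 ^ m)) := by
  induction m with
  | zero =>
    refine tendsto_const_nhds.congr fun k => ?_
    simp [(oddDoubleFactorial_pos k).ne']
  | succ m ih =>
    have h := ih.mul ((tendsto_const_div_atTop_nhds_zero_nat (2 * (m : ℝ) + 1)).const_add 2)
    rw [add_zero, ← pow_succ] at h
    refine h.congr' ?_
    filter_upwards [Filter.eventually_gt_atTop 0] with k hk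
    have hk' : (k : ℝ) ≠ 0 := Nat.cast_ne_zero.2 hk.ne'
    have := (oddDoubleFactorial_pos k).ne'
    rw [← add_assoc, oddDoubleFactorial_succ]
    push_cast
    field_simp
    ring

/-- The contribution of `k` to the expansion of `(2(k+m)-1)!!`, relative to `X k / (2k-1)!!`. -/
noncomputable def wiringWeight (k m : ℕ) : ℝ :=
  wiringPowCoeff k m * oddDoubleFactorial k / oddDoubleFactorial (k + m)

theorem wiringWeight_nonneg (k m : ℕ) : 0 ≤ wiringWeight k m :=
  div_nonneg (mul_nonneg (wiringPowCoeff_nonneg k m) (oddDoubleFactorial_pos k).le)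
    (oddDoubleFactorial_pos _).le

theorem wiringWeight_zero_right (k : ℕ) : wiringWeight k 0 = 1 := by
  simp [wiringWeight, wiringPowCoeff_zero_right, (oddDoubleFactorial_pos k).ne']

theorem wiringWeight_zero_succ (m : ℕ) : wiringWeight 0 (m + 1) = 0 := by
  simp [wiringWeight, wiringPowCoeff_zero_succ]

theorem wiringWeight_one (m : ℕ) : wiringWeight 1 m = 1 / (2 * m + 1) := by
  have := (oddDoubleFactorial_pos m).ne'
  have h1 : oddDoubleFactorial 1 = 1 := by simp [oddDoubleFactorial]
  rw [wiringWeight, wiringPowCoeff_one, add_comm 1 m, oddDoubleFactorial_succ m, h1]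
  field_simp

theorem wiringWeight_succ_succ (k m : ℕ) :
    wiringWeight (k + 1) (m + 1) * (2 * k + 2 * m + 3) =
      (2 * k + 1) * wiringWeight k (m + 1) +
        (1 + 2 * m / (k + 1)) * wiringWeight (k + 1) m := by
  have := (oddDoubleFactorial_pos (k + m)).ne'
  simp only [wiringWeight]
  rw [wiringPowCoeff_succ_succ, show k + 1 + (m + 1) = k + m + 1 + 1 by ring,
    show k + (m + 1) = k + m + 1 by ring, show k + 1 + m = k + m + 1 by ring]
  simp only [oddDoubleFactorial_succ]
  push_cast
  have h1 : 2 * ((k : ℝ) + m + 1) + 1 ≠ 0 := by positivity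
  have h2 : 2 * ((k : ℝ) + m) + 1 ≠ 0 := by positivity
  field_simp
  ring

theorem wiringWeight_add_two_le (k m : ℕ) :
    wiringWeight (k + 2) m ≤ 20 / ((m + 2) * (m + 3)) := by
  induction m generalizing k with
  | zero =>
    rw [wiringWeight_zero_right]
    norm_num
  | succ m ihm =>
    induction k with
    | zero =>
      have h := wiringWeight_succ_succ 1 m
      rw [wiringWeight_one] at h
      have h1 := mul_le_mul_of_nonneg_left (ihm 0)
        (by positivity : (0 : ℝ) ≤ 1 + 2 * m / ((1 : ℕ) + 1))
      have h2 : wiringWeight (1 + 1) (m + 1) * (2 * (1 : ℕ) + 2 * m + 3) ≤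
          20 / (((m + 1 : ℕ) + 2) * ((m + 1 : ℕ) + 3)) * (2 * (1 : ℕ) + 2 * m + 3) := by
        rw [h]
        refine (add_le_add_right h1 _).trans ?_
        rw [← sub_nonneg]
        push_cast
        have h3 : (20 : ℝ) / ((m + 1 + 2) * (m + 1 + 3)) * (2 * 1 + 2 * m + 3) -
            ((2 * 1 + 1) * (1 / (2 * (m + 1) + 1)) +
              (1 + 2 * m / (1 + 1)) * (20 / ((m + 2) * (m + 3)))) =
            (37 * m ^ 3 + 193 * m ^ 2 + 402 * m + 288) /
              ((m + 2) * (m + 3) * (m + 4) * (2 * m + 3)) := by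
          rw [show (m : ℝ) + 1 + 2 = m + 3 by ring, show (m : ℝ) + 1 + 3 = m + 4 by ring,
            show 2 * ((m : ℝ) + 1) + 1 = 2 * m + 3 by ring]
          field_simp
          ring
        rw [h3]
        positivity
      exact le_of_mul_le_mul_right h2 (by positivity)
    | succ k ihk =>
      have h := wiringWeight_succ_succ (k + 2) m
      have h1 := mul_le_mul_of_nonneg_left (ihm (k + 1))
        (by positivity : (0 : ℝ) ≤ 1 + 2 * m / ((k + 2 : ℕ) + 1))
      have h2 := mul_le_mul_of_nonneg_left ihk (by positivity : (0 : ℝ) ≤ 2 * (k + 2 : ℕ) + 1)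
      have h4 : (1 + 2 * (m : ℝ) / ((k + 2 : ℕ) + 1)) * (20 / ((m + 2) * (m + 3))) ≤
          (2 * m + 2) * (20 / (((m + 1 : ℕ) + 2) * ((m + 1 : ℕ) + 3))) := by
        have h5 : 1 + 2 * (m : ℝ) / ((k + 2 : ℕ) + 1) ≤ 1 + 2 * m / 3 := by
          gcongr
          push_cast
          linarith [k.cast_nonneg (α := ℝ)]
        refine (mul_le_mul_of_nonneg_right h5 (by positivity)).trans ?_
        push_cast
        rw [← mul_div_assoc, ← mul_div_assoc, div_le_div_iff₀ (by positivity) (by positivity)]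
        have hm := m.cast_nonneg (α := ℝ)
        nlinarith [mul_nonneg hm hm, mul_nonneg hm (mul_nonneg hm hm)]
      have h3 : wiringWeight (k + 2 + 1) (m + 1) * (2 * (k + 2 : ℕ) + 2 * m + 3) ≤
          20 / (((m + 1 : ℕ) + 2) * ((m + 1 : ℕ) + 3)) * (2 * (k + 2 : ℕ) + 2 * m + 3) := by
        rw [h]
        have h1' := h1.trans h4
        clear h1 h4 h
        rw [show k + 1 + 2 = k + 2 + 1 by ring] at h1'
        linarith
      exact le_of_mul_le_mul_right h3 (by positivity)

theorem tendsto_wiringWeight (m : ℕ) :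
    Filter.Tendsto (fun k => wiringWeight k m) Filter.atTop
      (nhds ((1 / 2) ^ m / m.factorial)) := by
  have h := (tendsto_wiringPowCoeff_div_pow m).div (tendsto_oddDoubleFactorial_add_div m)
    (by positivity)
  rw [show (1 / 2 : ℝ) ^ m / m.factorial = 1 / m.factorial / 2 ^ m by
    rw [one_div_pow, div_right_comm]]
  refine h.congr' ?_
  filter_upwards [Filter.eventually_gt_atTop 0] with k hk
  have hk' : (k : ℝ) ≠ 0 := Nat.cast_ne_zero.2 hk.ne'
  have h1 := (oddDoubleFactorial_pos k).ne'
  have h2 := (oddDoubleFactorial_pos (k + m)).ne'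
  simp only [Pi.div_apply, wiringWeight]
  field_simp

/-- The ratio `X_n / (2n-1)!!`. -/
noncomputable def networkDensity (n : ℕ) : ℝ := X n / oddDoubleFactorial n

theorem networkDensity_nonneg (n : ℕ) : 0 ≤ networkDensity n :=
  div_nonneg (Nat.cast_nonneg _) (oddDoubleFactorial_pos n).le

theorem sum_networkDensity_mul_wiringWeight (n : ℕ) :
    ∑ m ∈ Finset.range (n + 1), networkDensity (n - m) * wiringWeight (n - m) m = 1 := by
  have hn := (oddDoubleFactorial_pos n).ne'
  rw [← Finset.sum_range_reflect, ← div_self hn]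
  nth_rewrite 1 [oddDoubleFactorial_eq_sum n]
  rw [Finset.sum_div]
  refine Finset.sum_congr rfl fun k hk => ?_
  have hk' := Finset.mem_range_succ_iff.1 hk
  have h1 := (oddDoubleFactorial_pos k).ne'
  rw [show n + 1 - 1 - k = n - k by omega, show n - (n - k) = k by omega, networkDensity,
    wiringWeight, show k + (n - k) = n by omega]
  field_simp

theorem networkDensity_le_one (n : ℕ) : networkDensity n ≤ 1 := by
  rw [← sum_networkDensity_mul_wiringWeight n]
  have h := Finset.single_le_sum
    (f := fun m => networkDensity (n - m) * wiringWeight (n - m) m)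
    (fun m _ => mul_nonneg (networkDensity_nonneg _) (wiringWeight_nonneg _ _))
    (Finset.mem_range.2 n.succ_pos)
  simpa [wiringWeight_zero_right] using h

theorem summable_half_pow_div_factorial :
    Summable fun m : ℕ => (1 / 2 : ℝ) ^ m / m.factorial :=
  Real.summable_pow_div_factorial _

theorem summable_const_div_mul :
    Summable fun m : ℕ => (20 : ℝ) / ((m + 2) * (m + 3)) := by
  have h := ((Real.summable_one_div_nat_pow (p := 2)).2 one_lt_two).mul_left 20
  rw [← summable_nat_add_iff 1] at h
  refine h.of_nonneg_of_le (fun m => by positivity) fun m => ?_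
  push_cast
  rw [mul_one_div, pow_two]
  gcongr <;> linarith

/-- `wiringWeight` without its row `k = 1`, whose entries admit no summable bound. -/
noncomputable def truncatedWeight (k m : ℕ) : ℝ := if k = 1 then 0 else wiringWeight k m

theorem truncatedWeight_nonneg (k m : ℕ) : 0 ≤ truncatedWeight k m := by
  rw [truncatedWeight]
  split_ifs
  exacts [le_rfl, wiringWeight_nonneg k m]

theorem truncatedWeight_le (k m : ℕ) : truncatedWeight k m ≤ 20 / ((m + 2) * (m + 3)) := by
  rcases k with _ | _ | k
  · rcases m with _ | m
    · simp [truncatedWeight, wiringWeight_zero_right]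
      norm_num
    · simp [truncatedWeight, wiringWeight_zero_succ]
      positivity
  · simp [truncatedWeight]
    positivity
  · simpa [truncatedWeight] using wiringWeight_add_two_le k m

theorem tendsto_sum_networkDensity_mul_sub :
    Filter.Tendsto (fun n => ∑ m ∈ Finset.range (n + 1), networkDensity (n - m) *
      ((1 / 2) ^ m / m.factorial - truncatedWeight (n - m) m)) Filter.atTop (nhds 0) := by
  have h := tendsto_tsum_of_dominated_convergence (𝓕 := Filter.atTop)
    (f := fun (n m : ℕ) => if m ∈ Finset.range (n + 1) then networkDensity (n - m) *
      ((1 / 2) ^ m / m.factorial - truncatedWeight (n - m) m) else 0)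
    (g := fun _ => 0)
    (summable_half_pow_div_factorial.add summable_const_div_mul) (fun m => ?_)
    (Filter.Eventually.of_forall fun n m => ?_)
  · rw [tsum_zero] at h
    refine h.congr fun n => ?_
    rw [tsum_eq_sum (s := Finset.range (n + 1)) fun m hm => if_neg hm]
    exact Finset.sum_congr rfl fun m hm => if_pos hm
  · rw [← Filter.tendsto_add_atTop_iff_nat m]
    have hw : Filter.Tendsto
        (fun k => (1 / 2 : ℝ) ^ m / m.factorial - truncatedWeight k m)
        Filter.atTop (nhds 0) := by
      rw [← sub_self ((1 / 2 : ℝ) ^ m / m.factorial)]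
      refine ((tendsto_wiringWeight m).congr' ?_).const_sub _
      filter_upwards [Filter.eventually_gt_atTop 1] with k hk
      rw [truncatedWeight, if_neg hk.ne']
    have hw' := hw.norm
    rw [norm_zero] at hw'
    refine squeeze_zero_norm (fun k => ?_) hw'
    rw [if_pos (Finset.mem_range.2 (by omega)), Nat.add_sub_cancel, norm_mul,
      Real.norm_of_nonneg (networkDensity_nonneg k)]
    exact mul_le_of_le_one_left (norm_nonneg _) (networkDensity_le_one k)
  · have hw : (0 : ℝ) ≤ (1 / 2) ^ m / m.factorial := by positivity
    have h1 := truncatedWeight_nonneg (n - m) m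
    have h2 := truncatedWeight_le (n - m) m
    split_ifs
    · rw [norm_mul, Real.norm_of_nonneg (networkDensity_nonneg _)]
      refine (mul_le_of_le_one_left (norm_nonneg _) (networkDensity_le_one _)).trans ?_
      rw [Real.norm_eq_abs, abs_le]
      constructor <;> linarith
    · rw [norm_zero]
      linarith

theorem sum_networkDensity_mul_truncatedWeight (n : ℕ) :
    ∑ m ∈ Finset.range (n + 2), networkDensity (n + 1 - m) * truncatedWeight (n + 1 - m) m =
      1 - networkDensity 1 / (2 * n + 1) := by
  have h : ∑ m ∈ Finset.range (n + 2), (networkDensity (n + 1 - m) * wiringWeight (n + 1 - m) m -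
      networkDensity (n + 1 - m) * truncatedWeight (n + 1 - m) m) =
      networkDensity 1 / (2 * n + 1) := by
    rw [Finset.sum_eq_single_of_mem n (Finset.mem_range.2 (by omega))]
    · simp [truncatedWeight, wiringWeight_one, div_eq_mul_inv]
    · intro m hm hmn
      have hm' := Finset.mem_range.1 hm
      simp only [truncatedWeight]
      rw [if_neg (by omega), sub_self]
  rw [Finset.sum_sub_distrib, sum_networkDensity_mul_wiringWeight] at h
  linarith

theorem tendsto_sum_networkDensity_mul_half_pow :
    Filter.Tendsto (fun n => ∑ m ∈ Finset.range (n + 1), networkDensity (n - m) *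
      ((1 / 2) ^ m / m.factorial)) Filter.atTop (nhds 1) := by
  rw [← Filter.tendsto_add_atTop_iff_nat 1]
  have h1 := (Filter.tendsto_add_atTop_iff_nat 1).2 tendsto_sum_networkDensity_mul_sub
  have h2 : Filter.Tendsto (fun n : ℕ => networkDensity 1 / (2 * (n : ℝ) + 1)) Filter.atTop
      (nhds 0) :=
    Filter.Tendsto.const_div_atTop (Filter.tendsto_atTop_add_const_right _ _
      (tendsto_natCast_atTop_atTop.const_mul_atTop two_pos)) _
  have h3 := h1.add (h2.const_sub 1)
  rw [zero_add, sub_zero] at h3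
  refine h3.congr fun n => ?_
  rw [← sum_networkDensity_mul_truncatedWeight, ← Finset.sum_add_distrib]
  exact Finset.sum_congr rfl fun m _ => by ring

/-- Convolution with the coefficients of `exp (t / 2)` is inverted by convolution with those of
`exp (-t / 2)`. -/
theorem sum_neg_half_pow_mul_sum (f : ℕ → ℝ) (n : ℕ) :
    ∑ j ∈ Finset.range (n + 1), (-(1 / 2)) ^ j / j.factorial *
      ∑ m ∈ Finset.range (n - j + 1), f (n - j - m) * ((1 / 2) ^ m / m.factorial) = f n := by
  have hexp : ∀ (a : ℝ) (m : ℕ), coeff m (rescale a (exp ℝ)) = a ^ m / m.factorial := by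
    intro a m
    simp [coeff_rescale, coeff_exp, div_eq_mul_inv]
  have h : rescale (-(1 / 2) : ℝ) (exp ℝ) *
      (rescale (1 / 2 : ℝ) (exp ℝ) * PowerSeries.mk f) = PowerSeries.mk f := by
    rw [← mul_assoc, exp_mul_exp_eq_exp_add]
    simp
  have hn := congrArg (coeff n) h
  simp only [coeff_mul, coeff_mk, hexp, Finset.Nat.sum_antidiagonal_eq_sum_range_succ_mk] at hn
  rw [← hn]
  refine Finset.sum_congr rfl fun j _ => ?_
  congr 1
  exact Finset.sum_congr rfl fun m _ => mul_comm _ _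

/-- A convolution of a summable sequence with a convergent one converges to the product of the sum
and the limit. -/
theorem tendsto_sum_mul_of_summable {v e : ℕ → ℝ} {L : ℝ} (hv : Summable fun j => ‖v j‖)
    (he : Filter.Tendsto e Filter.atTop (nhds L)) :
    Filter.Tendsto (fun n => ∑ j ∈ Finset.range (n + 1), v j * e (n - j)) Filter.atTop
      (nhds ((∑' j, v j) * L)) := by
  obtain ⟨B, hB⟩ := (Metric.isBounded_range_of_tendsto e he).exists_norm_le
  have hB' : ∀ n, ‖e n‖ ≤ B := fun n => hB _ (Set.mem_range_self n)
  have hB0 : 0 ≤ B := (norm_nonneg _).trans (hB' 0)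
  have h := tendsto_tsum_of_dominated_convergence (𝓕 := Filter.atTop)
    (f := fun (n j : ℕ) => if j ∈ Finset.range (n + 1) then v j * e (n - j) else 0)
    (g := fun j => v j * L) (hv.mul_right B) (fun j => ?_)
    (Filter.Eventually.of_forall fun n j => ?_)
  · rw [tsum_mul_right] at h
    refine h.congr fun n => ?_
    rw [tsum_eq_sum (s := Finset.range (n + 1)) fun j hj => if_neg hj]
    exact Finset.sum_congr rfl fun j hj => if_pos hj
  · rw [← Filter.tendsto_add_atTop_iff_nat j]
    refine (he.const_mul (v j)).congr fun k => ?_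
    rw [if_pos (Finset.mem_range.2 (by omega)), Nat.add_sub_cancel]
  · split_ifs
    · rw [norm_mul]
      exact mul_le_mul_of_nonneg_left (hB' _) (norm_nonneg _)
    · rw [norm_zero]
      positivity

/-- `X_n/(2n-1)!! → e^{-1/2}` as `n → ∞`. -/
theorem X_div_doubleFactorial_tendsto_exp_neg_half :
    Filter.Tendsto
      (fun n : ℕ => (X n : ℝ) / (Nat.doubleFactorial (2 * n - 1) : ℝ))
      Filter.atTop (nhds (Real.exp (-(1 / 2)))) := by
  have hsum : Summable fun j : ℕ => ‖(-(1 / 2) : ℝ) ^ j / j.factorial‖ :=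
    (Real.summable_pow_div_factorial _).norm
  have h := tendsto_sum_mul_of_summable hsum tendsto_sum_networkDensity_mul_half_pow
  rw [mul_one, ← congrFun NormedSpace.exp_eq_tsum_div, ← Real.exp_eq_exp_ℝ] at h
  exact h.congr fun n => sum_neg_half_pow_mul_sum networkDensity n
end

section
/- The real sequence a_n = n·Σ_{j=2}^{n−2} (2j−1)!!·(2n−2j−1)!!/(2n−1)!! tends to 0 as n → ∞. -/
open scoped Nat in
theorem doubleFactorial_two_mul_succ_sub_one (k : ℕ) :
    (2 * (k + 1) - 1)‼ = (2 * k + 1) * (2 * k - 1)‼ :=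
  Nat.doubleFactorial_add_one (2 * k)

open scoped Nat in
theorem doubleFactorial_mul_le (a b c : ℕ) :
    (2 * (a + c) - 1)‼ * (2 * (b + c) - 1)‼ ≤
      (2 * c - 1)‼ * (2 * (a + b + c) - 1)‼ := by
  induction a with
  | zero => simp
  | succ a ih =>
    rw [show a + 1 + c = a + c + 1 by ring, show a + 1 + b + c = a + b + c + 1 by ring,
      doubleFactorial_two_mul_succ_sub_one, doubleFactorial_two_mul_succ_sub_one, mul_assoc,
      mul_left_comm (2 * c - 1)‼]
    exact Nat.mul_le_mul (by lia) ih

open scoped Nat in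
theorem pow_mul_doubleFactorial_le {n c : ℕ} (hc : c ≤ n) (h : 2 * c ≤ n + 1) :
    n ^ c * (2 * (n - c) - 1)‼ ≤ (2 * n - 1)‼ := by
  induction c with
  | zero => simp
  | succ c ih =>
    refine le_trans ?_ (ih (by lia) (by lia))
    rw [show n - c = n - (c + 1) + 1 by lia, doubleFactorial_two_mul_succ_sub_one, pow_succ,
      mul_assoc]
    gcongr
    lia

open scoped Nat in
theorem doubleFactorial_ratio_le {n c j : ℕ} (hn : 0 < n) (h : 2 * c ≤ n + 1) (hj : c ≤ j)
    (hjn : j + c ≤ n) :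
    (((2 * j - 1)‼ : ℝ) * ((2 * n - 2 * j - 1)‼ : ℝ)) / ((2 * n - 1)‼ : ℝ) ≤
      ((2 * c - 1)‼ : ℝ) / (n : ℝ) ^ c := by
  have hprod := doubleFactorial_mul_le (j - c) (n - j - c) c
  rw [show j - c + c = j by lia, show n - j - c + c = n - j by lia,
    show j - c + (n - j - c) + c = n - c by lia, Nat.mul_sub] at hprod
  have hpow := pow_mul_doubleFactorial_le (show c ≤ n by lia) h
  rw [div_le_div_iff₀ (mod_cast Nat.doubleFactorial_pos _) (by positivity)]
  norm_cast
  calc (2 * j - 1)‼ * (2 * n - 2 * j - 1)‼ * n ^ c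
      ≤ (2 * c - 1)‼ * (2 * (n - c) - 1)‼ * n ^ c := by gcongr
    _ = (2 * c - 1)‼ * (n ^ c * (2 * (n - c) - 1)‼) := by ring
    _ ≤ (2 * c - 1)‼ * (2 * n - 1)‼ := by gcongr

open scoped Nat in
theorem sum_doubleFactorial_ratio_le {n : ℕ} (hn : 5 ≤ n) :
    ∑ j ∈ Finset.Icc 2 (n - 2),
        (((2 * j - 1)‼ : ℝ) * ((2 * n - 2 * j - 1)‼ : ℝ)) / ((2 * n - 1)‼ : ℝ) ≤
      21 / (n : ℝ) ^ 2 := by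
  have hn0 : (0 : ℝ) < n := by positivity
  calc _ ≤ ∑ j ∈ Finset.Icc 2 (n - 2), (15 / (n : ℝ) ^ 3 +
        ((if j = 2 then 3 / (n : ℝ) ^ 2 else 0) +
          if j = n - 2 then 3 / (n : ℝ) ^ 2 else 0)) := by
        refine Finset.sum_le_sum fun j hj => ?_
        rw [Finset.mem_Icc] at hj
        have h15 : (0 : ℝ) ≤ 15 / (n : ℝ) ^ 3 := by positivity
        have h3 : (0 : ℝ) ≤ 3 / (n : ℝ) ^ 2 := by positivity
        by_cases hmid : 3 ≤ j ∧ j + 3 ≤ n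
        · have := doubleFactorial_ratio_le (by lia) (by lia) hmid.1 hmid.2
          norm_num [Nat.doubleFactorial] at this
          split_ifs <;> linarith
        · have := doubleFactorial_ratio_le (n := n) (by lia) (by lia) hj.1 (by lia)
          norm_num [Nat.doubleFactorial] at this
          split_ifs <;> first | linarith | lia
    _ = ((n - 2 + 1 - 2 : ℕ) : ℝ) * (15 / (n : ℝ) ^ 3) +
        (3 / (n : ℝ) ^ 2 + 3 / (n : ℝ) ^ 2) := by
        rw [Finset.sum_add_distrib, Finset.sum_add_distrib, Finset.sum_ite_eq',
          Finset.sum_ite_eq', if_pos (by rw [Finset.mem_Icc]; lia),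
          if_pos (by rw [Finset.mem_Icc]; lia)]
        simp
    _ ≤ (n : ℝ) * (15 / (n : ℝ) ^ 3) + (3 / (n : ℝ) ^ 2 + 3 / (n : ℝ) ^ 2) := by
        gcongr
        lia
    _ = 21 / (n : ℝ) ^ 2 := by
        field_simp
        norm_num

/-- The real sequence `a_n = n · ∑_{j=2}^{n-2} (2j-1)!!·(2n-2j-1)!!/(2n-1)!!`
tends to `0` as `n → ∞`. -/
theorem tendsto_doubleFactorial_ratio_sum_zero :
    Filter.Tendsto
      (fun n : ℕ => (n : ℝ) * ∑ j ∈ Finset.Icc 2 (n - 2),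
        ((Nat.doubleFactorial (2 * j - 1) : ℝ) *
            (Nat.doubleFactorial (2 * n - 2 * j - 1) : ℝ)) /
          (Nat.doubleFactorial (2 * n - 1) : ℝ))
      Filter.atTop (nhds 0) := by
  refine tendsto_of_tendsto_of_tendsto_of_le_of_le' tendsto_const_nhds
    (tendsto_const_div_atTop_nhds_zero_nat 21) (Filter.Eventually.of_forall fun n => ?_) ?_
  · positivity
  · filter_upwards [Filter.eventually_ge_atTop 5] with n hn
    have hn0 : (0 : ℝ) < n := by positivity
    calc _ ≤ (n : ℝ) * (21 / (n : ℝ) ^ 2) :=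
          mul_le_mul_of_nonneg_left (sum_doubleFactorial_ratio_le hn) hn0.le
      _ = 21 / (n : ℝ) := by field_simp
end
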